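/- Let A_{-1}, A_0, A_1, G be as in the context, with G𝟙 = 𝟙, and let σ < 1 be a real number such that (A_{-1} − A_1)𝟙 ≥ (1 − σ)𝟙 entrywise. Let X : ℕ → B(ℓ∞) satisfy: X_0 is positive with X_0𝟙 = 𝟙 and, for every k, (I − A_0 − A_1X_k) X_{k+1} = A_{-1}. Then for every k the operator I − A_0 − A_1X_k is invertible in B(ℓ∞), X_k is positive with X_k𝟙 = 𝟙, ‖(I − A_0 − A_1X_k)^{-1} A_1‖ ≤ 1, and for every w ∈ ℓ∞ and λ ∈ ℝ with Gw = λw the error E_k := G − X_k satisfies ‖E_{k+1} w‖ ≤ |λ| · ‖(I − A_0 − A_1X_k)^{-1} A_1‖ · ‖E_k w‖. -/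

import Mathlib

open BoundedContinuousFunction Filter

noncomputable section

/-- ℓ∞: the Banach space of bounded real sequences with the sup norm. -/
abbrev Linf : Type := BoundedContinuousFunction ℕ ℝ

/-- A sequence is nonnegative if all its entries are nonnegative. -/
def vnonneg (x : Linf) : Prop := ∀ i, 0 ≤ x i

/-- An operator in B(ℓ∞) is positive if it maps nonnegative sequences to
nonnegative sequences. -/
def OpPos (A : Linf →L[ℝ] Linf) : Prop := ∀ x : Linf, vnonneg x → vnonneg (A x)

/-- The constant sequence with all entries equal to one. -/
def ones : Linf := BoundedContinuousFunction.const ℕ (1 : ℝ)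

theorem mul_sub_eq_of_quadratic {R : Type*} [Ring R] {c b a g x y : R}
    (hg : a * g ^ 2 + b * g + c = g) (hy : (1 - b - a * x) * y = c) :
    (1 - b - a * x) * (g - y) = a * (g - x) * g := by
  rw [mul_sub, hy]
  calc (1 - b - a * x) * g - c = g - b * g - a * x * g - c := by noncomm_ring
    _ = (a * g ^ 2 + b * g + c) - b * g - a * x * g - c := by rw [hg]
    _ = a * (g - x) * g := by noncomm_ring

theorem ones_apply (i : ℕ) : ones i = 1 := rfl

theorem OpPos.mono {A : Linf →L[ℝ] Linf} (hA : OpPos A) {x y : Linf}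
    (h : ∀ i, x i ≤ y i) (i : ℕ) : A x i ≤ A y i := by
  have := hA (y - x) (fun j => by simpa using h j) i
  simpa [map_sub] using this

theorem OpPos.add {A B : Linf →L[ℝ] Linf} (hA : OpPos A) (hB : OpPos B) : OpPos (A + B) :=
  fun x hx i => add_nonneg (hA x hx i) (hB x hx i)

theorem OpPos.mul {A B : Linf →L[ℝ] Linf} (hA : OpPos A) (hB : OpPos B) : OpPos (A * B) :=
  fun x hx => hA (B x) (hB x hx)

theorem vnonneg_ones : vnonneg ones := fun i => by simp [ones_apply]

/-- The norm of a positive operator is controlled by its value at the constant sequence. -/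
theorem OpPos.norm_le {A : Linf →L[ℝ] Linf} (hA : OpPos A) {c : ℝ} (hc : ∀ i, A ones i ≤ c) :
    ‖A‖ ≤ c := by
  have hc0 : 0 ≤ c := (hA ones vnonneg_ones 0).trans (hc 0)
  refine ContinuousLinearMap.opNorm_le_bound _ hc0 fun x => ?_
  refine (BoundedContinuousFunction.norm_le (by positivity)).2 fun i => ?_
  have key : ∀ j, |x j| ≤ ‖x‖ := fun j => x.norm_coe_le_norm j
  have h1 := hA.mono (x := x) (y := ‖x‖ • ones)
    (fun j => by simpa [ones_apply] using (abs_le.1 (key j)).2) i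
  have h2 := hA.mono (x := -(‖x‖ • ones)) (y := x)
    (fun j => by simpa [ones_apply] using (abs_le.1 (key j)).1) i
  have h3 : ‖x‖ * A ones i ≤ ‖x‖ * c := mul_le_mul_of_nonneg_left (hc i) (norm_nonneg x)
  simp only [map_neg, map_smul, BoundedContinuousFunction.coe_neg, Pi.neg_apply,
    BoundedContinuousFunction.coe_smul, smul_eq_mul] at h1 h2
  rw [Real.norm_eq_abs, abs_le]
  constructor <;> linarith

/-- Minimum principle for `1 - P`, where `P` is positive with `P ones ≤ σ < 1`. -/
theorem OpPos.vnonneg_of_sub {P : Linf →L[ℝ] Linf} (hP : OpPos P) {σ : ℝ} (hσ : σ < 1)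
    (hPσ : ∀ i, P ones i ≤ σ) {y : Linf} (hy : vnonneg ((1 - P) y)) : vnonneg y := by
  have hbdd : BddBelow (Set.range fun i => y i) :=
    ⟨-‖y‖, by rintro _ ⟨i, rfl⟩; exact (abs_le.1 (y.norm_coe_le_norm i)).1⟩
  have hle : ∀ i, (⨅ j, y j) ≤ y i := fun i => ciInf_le hbdd i
  suffices h : 0 ≤ ⨅ j, y j from fun i => h.trans (hle i)
  by_contra! hneg
  have hstep : σ * (⨅ j, y j) ≤ ⨅ j, y j := by
    refine le_ciInf fun i => ?_
    have h1 := hP.mono (x := (⨅ j, y j) • ones) (y := y)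
      (fun j => by simpa [ones_apply] using hle j) i
    have h2 : P y i ≤ y i := by simpa using hy i
    have h3 := mul_le_mul_of_nonpos_right (hPσ i) hneg.le
    simp only [map_smul, BoundedContinuousFunction.coe_smul, smul_eq_mul] at h1
    linarith
  nlinarith

/-- If `P` is positive with `P ones ≤ σ < 1`, then `1 - P` has a positive inverse. -/
theorem OpPos.exists_inverse_one_sub {P : Linf →L[ℝ] Linf} (hP : OpPos P) {σ : ℝ} (hσ : σ < 1)
    (hPσ : ∀ i, P ones i ≤ σ) :
    ∃ B : Linf →L[ℝ] Linf, (1 - P) * B = 1 ∧ B * (1 - P) = 1 ∧ OpPos B := by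
  have hnorm : ‖P‖ < 1 := (hP.norm_le hPσ).trans_lt hσ
  obtain ⟨u, hu⟩ : IsUnit (1 - P) :=
    isUnit_one_sub_of_norm_lt_one (R := Linf →L[ℝ] Linf) hnorm
  have hr : (1 - P) * (↑u⁻¹ : Linf →L[ℝ] Linf) = 1 := by rw [← hu, Units.mul_inv]
  refine ⟨↑u⁻¹, hr, by rw [← hu, Units.inv_mul], fun x hx => ?_⟩
  refine hP.vnonneg_of_sub hσ hPσ ?_
  have : (1 - P) ((↑u⁻¹ : Linf →L[ℝ] Linf) x) = x := DFunLike.congr_fun hr x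
  rwa [this]

/-- Iteration F₃ with a row-stochastic starting matrix: each I - A₀ - A₁Xₖ is
invertible, the iterates remain row-stochastic, ‖(I-A₀-A₁Xₖ)⁻¹A₁‖ ≤ 1, and
the error along eigenvectors of G contracts with factor
|λ|·‖(I-A₀-A₁Xₖ)⁻¹A₁‖. -/
theorem stmt6
    (Am1 A0 A1 G : Linf →L[ℝ] Linf)
    (hAm1 : OpPos Am1) (hA0 : OpPos A0) (hA1 : OpPos A1) (hG : OpPos G)
    (hstoch : (Am1 + A0 + A1) ones = ones)
    (heq : A1 * G ^ 2 + A0 * G + Am1 = G)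
    (hG1 : G ones = ones)
    (σ : ℝ) (hσ : σ < 1)
    (hgap : ∀ i, 1 - σ ≤ ((Am1 - A1) ones) i)
    (X : ℕ → Linf →L[ℝ] Linf)
    (hX0 : OpPos (X 0)) (hX01 : (X 0) ones = ones)
    (hXrec : ∀ k, (1 - A0 - A1 * X k) * X (k + 1) = Am1) :
    ∀ k, ∃ B : Linf →L[ℝ] Linf,
      (1 - A0 - A1 * X k) * B = 1 ∧ B * (1 - A0 - A1 * X k) = 1 ∧
      OpPos (X k) ∧ (X k) ones = ones ∧
      ‖B * A1‖ ≤ 1 ∧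
      ∀ (w : Linf) (lam : ℝ), G w = lam • w →
        ‖(G - X (k + 1)) w‖ ≤ |lam| * ‖B * A1‖ * ‖(G - X k) w‖ := by
  have hAm1ones : Am1 ones = ones - A0 ones - A1 ones := by
    have h : Am1 ones + A0 ones + A1 ones = ones := hstoch
    exact eq_sub_of_add_eq (eq_sub_of_add_eq (by rwa [add_right_comm]))
  have hsub : ∀ k, 1 - A0 - A1 * X k = 1 - (A0 + A1 * X k) := fun k => by abel
  have hPones : ∀ k, X k ones = ones → (1 - A0 - A1 * X k) ones = Am1 ones := by
    intro k h1
    rw [hAm1ones]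
    change ones - A0 ones - A1 (X k ones) = _
    rw [h1]
  have hinv : ∀ k, OpPos (X k) → X k ones = ones → ∃ B : Linf →L[ℝ] Linf,
      (1 - A0 - A1 * X k) * B = 1 ∧ B * (1 - A0 - A1 * X k) = 1 ∧ OpPos B := by
    intro k hk h1
    rw [hsub k]
    refine (hA0.add (hA1.mul hk)).exists_inverse_one_sub hσ fun i => ?_
    have e : (A0 + A1 * X k) ones = A0 ones + A1 ones := by
      change A0 ones + A1 (X k ones) = _
      rw [h1]
    have h2 : 1 - σ ≤ Am1 ones i - A1 ones i := hgap i
    have h3 := hA1 ones vnonneg_ones i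
    rw [hAm1ones] at h2
    rw [e]
    simp only [BoundedContinuousFunction.coe_sub, BoundedContinuousFunction.coe_add,
      Pi.sub_apply, Pi.add_apply, ones_apply] at h2 ⊢
    linarith
  have hX : ∀ k, OpPos (X k) ∧ X k ones = ones := by
    intro k
    induction k with
    | zero => exact ⟨hX0, hX01⟩
    | succ k ih =>
      obtain ⟨B, -, hB, hBpos⟩ := hinv k ih.1 ih.2
      have e : X (k + 1) = B * Am1 := by rw [← hXrec k, ← mul_assoc, hB, one_mul]
      refine ⟨e ▸ hBpos.mul hAm1, ?_⟩
      rw [e]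
      change B (Am1 ones) = ones
      rw [← hPones k ih.2]
      exact DFunLike.congr_fun hB ones
  intro k
  obtain ⟨hk, h1⟩ := hX k
  obtain ⟨B, hB', hB, hBpos⟩ := hinv k hk h1
  refine ⟨B, hB', hB, hk, h1, ?_, fun w lam hw => ?_⟩
  · refine (hBpos.mul hA1).norm_le fun i => ?_
    have h2 : B (Am1 ones) = ones := by
      rw [← hPones k h1]
      exact DFunLike.congr_fun hB ones
    have h3 : B (A1 ones) i ≤ B (Am1 ones) i := hBpos.mono (fun j => by
      have h : 1 - σ ≤ Am1 ones j - A1 ones j := hgap j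
      linarith) i
    rwa [h2] at h3
  · have e : G - X (k + 1) = B * A1 * (G - X k) * G := by
      have h2 : (1 - A0 - A1 * X k) * (G - X (k + 1)) = A1 * (G - X k) * G :=
        mul_sub_eq_of_quadratic (R := Linf →L[ℝ] Linf) heq (hXrec k)
      calc G - X (k + 1) = B * (1 - A0 - A1 * X k) * (G - X (k + 1)) := by rw [hB, one_mul]
        _ = B * A1 * (G - X k) * G := by rw [mul_assoc, h2]; simp only [mul_assoc]
    have e2 : (G - X (k + 1)) w = lam • (B * A1) ((G - X k) w) := by
      rw [e]
      change (B * A1) ((G - X k) (G w)) = _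
      rw [hw, map_smul, map_smul]
    rw [e2, norm_smul, Real.norm_eq_abs, mul_assoc]
    exact mul_le_mul_of_nonneg_left ((B * A1).le_opNorm _) (abs_nonneg _)
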